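/- Let Γ be a discrete group and ω a weight on Γ such that the weighted convolution algebra ℓ¹(Γ,ω) is directly finite. Let f : Γ → ℂ satisfy Σ_{x∈Γ} |f(x)|ω(x) < ∞, and let ρ^ω_f : ℓ∞(Γ) → ℓ∞(Γ) be the weighted convolution operator ρ^ω_f(g)(x) = Σ_{y∈Γ} (ω(xy)/ω(x)) g(xy) f(y). Then the following are equivalent: (i) ρ^ω_f is injective; (ii) ρ^ω_f is bijective; (iii) f is invertible in ℓ¹(Γ,ω), i.e. there exists g : Γ → ℂ with Σ_x |g(x)|ω(x) < ∞ and f*g = δ_e = g*f. -/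

import Mathlib

/-- Convolution: `(f * g)(z) = ∑_{y} f(zy⁻¹) g(y)`. -/
noncomputable def conv {Γ : Type*} [Group Γ] (f g : Γ → ℂ) : Γ → ℂ :=
  fun z => ∑' y : Γ, f (z * y⁻¹) * g y

open Classical in
/-- The unit `δ_e`, the indicator function of the identity element. -/
noncomputable def deltaOne (Γ : Type*) [Group Γ] : Γ → ℂ :=
  fun z => if z = 1 then 1 else 0

/-- The weighted convolution operator
`ρ^ω_f(g)(x) = ∑_{y} (ω(xy)/ω(x)) g(xy) f(y)` on `ℓ∞(Γ)`. -/
noncomputable def rhoW {Γ : Type*} [Group Γ] (ω : Γ → ℝ) (f g : Γ → ℂ) : Γ → ℂ :=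
  fun x => ∑' y : Γ, ((ω (x * y) / ω x : ℝ) : ℂ) * g (x * y) * f y

/-- `g ∈ ℓ∞(Γ)`. -/
def IsBddFun {Γ : Type*} (g : Γ → ℂ) : Prop := ∃ C, ∀ x, ‖g x‖ ≤ C

/-- `a` belongs to `ℓ¹(Γ,ω)`. -/
def WeightedSummable {Γ : Type*} (ω : Γ → ℝ) (a : Γ → ℂ) : Prop :=
  Summable fun x => ‖a x‖ * ω x

section Weighted

variable {Γ : Type*} {ω : Γ → ℝ} {a b : Γ → ℂ}

theorem WeightedSummable.sub (ha : WeightedSummable ω a) (hb : WeightedSummable ω b)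
    (hpos : ∀ x, 0 < ω x) : WeightedSummable ω (a - b) := by
  refine Summable.of_nonneg_of_le (fun x => mul_nonneg (norm_nonneg _) (hpos x).le) (fun x => ?_)
    (Summable.add ha hb)
  rw [← add_mul]
  exact mul_le_mul_of_nonneg_right (norm_sub_le _ _) (hpos x).le

theorem WeightedSummable.norm_mul_le (hpos : ∀ x, 0 < ω x) (ha : WeightedSummable ω a) (x : Γ) :
    ‖a x‖ * ω x ≤ ∑' y, ‖a y‖ * ω y :=
  ha.le_tsum x fun y _ => mul_nonneg (norm_nonneg _) (hpos y).le

theorem summable_weighted_prod (hpos : ∀ x, 0 < ω x) (ha : WeightedSummable ω a)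
    (hb : WeightedSummable ω b) :
    Summable fun p : Γ × Γ => (‖a p.1‖ * ω p.1) * (‖b p.2‖ * ω p.2) :=
  Summable.mul_of_nonneg ha hb (fun x => mul_nonneg (norm_nonneg _) (hpos x).le)
    (fun x => mul_nonneg (norm_nonneg _) (hpos x).le)

theorem norm_ofReal_weight (hpos : ∀ x, 0 < ω x) (x : Γ) : ‖(ω x : ℂ)‖ = 1 * ω x := by
  rw [one_mul, Complex.norm_real, Real.norm_of_nonneg (hpos x).le]

/-- The element `ω a` of the unweighted `ℓ¹(Γ)` attached to `a ∈ ℓ¹(Γ,ω)`. -/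
noncomputable def WeightedSummable.toLp (hpos : ∀ x, 0 < ω x) (ha : WeightedSummable ω a) :
    lp (fun _ : Γ => ℂ) 1 :=
  ⟨fun x => a x * ω x, memℓp_gen <| by
    simpa [WeightedSummable, abs_of_pos (hpos _)] using ha⟩

theorem norm_lp_one (A : lp (fun _ : Γ => ℂ) 1) : ‖A‖ = ∑' x, ‖A x‖ := by
  simp [lp.norm_eq_tsum_rpow (p := 1) (by simp)]

theorem norm_toLp (hpos : ∀ x, 0 < ω x) (ha : WeightedSummable ω a) :
    ‖ha.toLp hpos‖ = ∑' x, ‖a x‖ * ω x := by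
  rw [norm_lp_one]
  simp [WeightedSummable.toLp, abs_of_pos (hpos _)]

theorem weightedSummable_div (hpos : ∀ x, 0 < ω x) (A : lp (fun _ : Γ => ℂ) 1) :
    WeightedSummable ω fun x => A x / ω x := by
  have h := (memℓp_gen_iff (p := 1) (by simp)).1 (lp.memℓp A)
  simpa [WeightedSummable, abs_of_pos (hpos _), div_mul_cancel₀ _ (hpos _).ne'] using h

theorem toLp_div (hpos : ∀ x, 0 < ω x) (A : lp (fun _ : Γ => ℂ) 1) :
    (weightedSummable_div hpos A).toLp hpos = A := by
  ext x
  have hx : (ω x : ℂ) ≠ 0 := by exact_mod_cast (hpos _).ne'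
  simp [WeightedSummable.toLp, hx]

end Weighted

/-- The bijection `(y, z) ↦ (yz, z)` of `Γ × Γ`. -/
def mulShear (Γ : Type*) [Group Γ] : Γ × Γ ≃ Γ × Γ where
  toFun p := (p.1 * p.2, p.2)
  invFun p := (p.1 * p.2⁻¹, p.2)
  left_inv p := by simp
  right_inv p := by simp

section Convolution

variable {Γ : Type*} [Group Γ] {ω : Γ → ℝ} {a b c F : Γ → ℂ} {C : ℝ}

theorem weightedSummable_deltaOne : WeightedSummable ω (deltaOne Γ) :=
  summable_of_ne_finset_zero (s := {1}) fun x hx => by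
    simp [deltaOne, Finset.notMem_singleton.1 hx]

theorem norm_mul_mul_le (hsub : ∀ x y, ω (x * y) ≤ ω x * ω y) (hC : 0 ≤ C)
    (hF : ∀ x, ‖F x‖ ≤ C * ω x) (y z : Γ) :
    ‖F (y * z) * a y * b z‖ ≤ C * ((‖a y‖ * ω y) * (‖b z‖ * ω z)) := by
  rw [norm_mul, norm_mul]
  calc ‖F (y * z)‖ * ‖a y‖ * ‖b z‖ ≤ C * (ω y * ω z) * ‖a y‖ * ‖b z‖ := by
        gcongr
        exact (hF _).trans (mul_le_mul_of_nonneg_left (hsub y z) hC)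
    _ = _ := by ring

theorem summable_pairing (hpos : ∀ x, 0 < ω x) (hsub : ∀ x y, ω (x * y) ≤ ω x * ω y)
    (hC : 0 ≤ C) (hF : ∀ x, ‖F x‖ ≤ C * ω x)
    (ha : WeightedSummable ω a) (hb : WeightedSummable ω b) :
    Summable fun p : Γ × Γ => F (p.1 * p.2) * a p.1 * b p.2 :=
  Summable.of_norm_bounded ((summable_weighted_prod hpos ha hb).mul_left C)
    fun p => norm_mul_mul_le hsub hC hF p.1 p.2

theorem summable_pairing_shear (hpos : ∀ x, 0 < ω x) (hsub : ∀ x y, ω (x * y) ≤ ω x * ω y)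
    (hC : 0 ≤ C) (hF : ∀ x, ‖F x‖ ≤ C * ω x)
    (ha : WeightedSummable ω a) (hb : WeightedSummable ω b) :
    Summable fun p : Γ × Γ => F p.1 * a (p.1 * p.2⁻¹) * b p.2 := by
  rw [← (mulShear Γ).summable_iff]
  simpa [mulShear, Function.comp_def] using summable_pairing hpos hsub hC hF ha hb

theorem tsum_mul_conv (hpos : ∀ x, 0 < ω x) (hsub : ∀ x y, ω (x * y) ≤ ω x * ω y)
    (hC : 0 ≤ C) (hF : ∀ x, ‖F x‖ ≤ C * ω x)
    (ha : WeightedSummable ω a) (hb : WeightedSummable ω b) :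
    ∑' w, F w * conv a b w = ∑' y, (∑' z, F (y * z) * b z) * a y := by
  have h := (summable_pairing hpos hsub hC hF ha hb).tsum_prod
  have h' := (summable_pairing_shear hpos hsub hC hF ha hb).tsum_prod
  rw [← (mulShear Γ).tsum_eq] at h'
  simp only [mulShear, Equiv.coe_fn_mk, mul_inv_cancel_right] at h'
  simp only [conv, ← tsum_mul_left, ← tsum_mul_right]
  calc _ = _ := by simp only [mul_assoc]
    _ = _ := h'.symm.trans h
    _ = _ := by simp only [mul_right_comm]

theorem summable_conv (hpos : ∀ x, 0 < ω x) (hsub : ∀ x y, ω (x * y) ≤ ω x * ω y)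
    (ha : WeightedSummable ω a) (hb : WeightedSummable ω b) (z : Γ) :
    Summable fun y => a (z * y⁻¹) * b y := by
  have h := (summable_pairing_shear hpos hsub zero_le_one
    (fun x => (norm_ofReal_weight hpos x).le) ha hb).prod_factor z
  simp only [mul_assoc] at h
  exact (summable_mul_left_iff (by exact_mod_cast (hpos z).ne')).1 h

theorem weightedSummable_conv_and_le (hpos : ∀ x, 0 < ω x)
    (hsub : ∀ x y, ω (x * y) ≤ ω x * ω y)
    (ha : WeightedSummable ω a) (hb : WeightedSummable ω b) :
    WeightedSummable ω (conv a b) ∧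
      ∑' x, ‖conv a b x‖ * ω x ≤ (∑' x, ‖a x‖ * ω x) * ∑' x, ‖b x‖ * ω x := by
  have hF := fun x => (norm_ofReal_weight hpos x).le
  have hs := (summable_pairing_shear hpos hsub zero_le_one hF ha hb).norm
  have hle : ∀ x, ‖conv a b x‖ * ω x ≤ ∑' y, ‖(ω x : ℂ) * a (x * y⁻¹) * b y‖ := fun x => by
    have h : ‖conv a b x‖ * ω x = ‖∑' y, (ω x : ℂ) * a (x * y⁻¹) * b y‖ := by
      simp only [mul_assoc, tsum_mul_left]
      rw [norm_mul, norm_ofReal_weight hpos, one_mul, mul_comm, conv]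
    rw [h]
    exact norm_tsum_le_tsum_norm (hs.prod_factor x)
  have hw : WeightedSummable ω (conv a b) :=
    Summable.of_nonneg_of_le (fun x => mul_nonneg (norm_nonneg _) (hpos x).le) hle hs.prod
  refine ⟨hw, (hw.tsum_le_tsum hle hs.prod).trans ?_⟩
  rw [← hs.tsum_prod, ← (mulShear Γ).tsum_eq,
    Summable.tsum_mul_tsum ha hb (summable_weighted_prod hpos ha hb)]
  refine Summable.tsum_le_tsum (fun p => ?_) ((mulShear Γ).summable_iff.2 hs)
    (summable_weighted_prod hpos ha hb)
  simpa [mulShear] using norm_mul_mul_le (a := a) (b := b) hsub zero_le_one hF p.1 p.2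

theorem conv_eq_tsum_left (a b : Γ → ℂ) (z : Γ) : conv a b z = ∑' x, b (x⁻¹ * z) * a x := by
  rw [conv, ← ((Equiv.inv Γ).trans (Equiv.mulRight z)).tsum_eq]
  simp [mul_comm]

theorem conv_deltaOne (a : Γ → ℂ) : conv a (deltaOne Γ) = a := by
  ext z
  rw [conv, tsum_eq_single 1 (fun y hy => by simp [deltaOne, hy])]
  simp [deltaOne]

theorem conv_sub_left (hpos : ∀ x, 0 < ω x) (hsub : ∀ x y, ω (x * y) ≤ ω x * ω y)
    (ha : WeightedSummable ω a) (hb : WeightedSummable ω b) (hc : WeightedSummable ω c) :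
    conv a (b - c) = conv a b - conv a c := by
  ext z
  simp only [conv, Pi.sub_apply, mul_sub]
  exact (summable_conv hpos hsub ha hb z).tsum_sub (summable_conv hpos hsub ha hc z)

theorem conv_assoc (hpos : ∀ x, 0 < ω x) (hsub : ∀ x y, ω (x * y) ≤ ω x * ω y)
    (ha : WeightedSummable ω a) (hb : WeightedSummable ω b) (hc : WeightedSummable ω c) :
    conv (conv a b) c = conv a (conv b c) := by
  ext z
  have hN : 0 ≤ ∑' y, ‖c y‖ * ω y :=
    tsum_nonneg fun y => mul_nonneg (norm_nonneg _) (hpos y).le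
  have hF : ∀ w, ‖c (w⁻¹ * z)‖ ≤ (∑' y, ‖c y‖ * ω y) / ω z * ω w := fun w => by
    have h₁ := hc.norm_mul_le hpos (w⁻¹ * z)
    have h₂ := hsub w (w⁻¹ * z)
    rw [mul_inv_cancel_left] at h₂
    rw [div_mul_eq_mul_div, le_div_iff₀ (hpos z)]
    calc _ ≤ ‖c (w⁻¹ * z)‖ * (ω w * ω (w⁻¹ * z)) := by gcongr
      _ = ‖c (w⁻¹ * z)‖ * ω (w⁻¹ * z) * ω w := by ring
      _ ≤ _ := mul_le_mul_of_nonneg_right h₁ (hpos w).le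
  rw [conv_eq_tsum_left, tsum_mul_conv (F := fun w => c (w⁻¹ * z)) hpos hsub
    (div_nonneg hN (hpos z).le) hF ha hb, conv_eq_tsum_left]
  simp only [conv_eq_tsum_left b c, mul_inv_rev, mul_assoc]

end Convolution

section Operator

variable {Γ : Type*} [Group Γ] {ω : Γ → ℝ} {f g h : Γ → ℂ}

theorem rhoW_eq (f h : Γ → ℂ) (x : Γ) :
    rhoW ω f h x = (∑' y, (ω (x * y) : ℂ) * h (x * y) * f y) / ω x := by
  rw [rhoW, div_eq_mul_inv, ← tsum_mul_right]
  congr 1 with y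
  push_cast
  ring

theorem norm_translate_le (hpos : ∀ x, 0 < ω x) (hsub : ∀ x y, ω (x * y) ≤ ω x * ω y)
    {C : ℝ} (hh : ∀ x, ‖h x‖ ≤ C) (x y : Γ) :
    ‖(ω (x * y) : ℂ) * h (x * y)‖ ≤ C * ω x * ω y := by
  rw [norm_mul, norm_ofReal_weight hpos, one_mul]
  calc _ ≤ ω x * ω y * C := mul_le_mul (hsub x y) (hh _) (norm_nonneg _)
        (mul_pos (hpos x) (hpos y)).le
    _ = _ := by ring

theorem rhoW_rhoW (hpos : ∀ x, 0 < ω x) (hsub : ∀ x y, ω (x * y) ≤ ω x * ω y)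
    (hf : WeightedSummable ω f) (hg : WeightedSummable ω g) (hh : IsBddFun h) :
    rhoW ω f (rhoW ω g h) = rhoW ω (conv f g) h := by
  obtain ⟨C, hC⟩ := hh
  ext x
  have hC0 : 0 ≤ C := (norm_nonneg _).trans (hC 1)
  rw [rhoW_eq, rhoW_eq, tsum_mul_conv (F := fun w => (ω (x * w) : ℂ) * h (x * w)) hpos hsub
    (mul_nonneg hC0 (hpos x).le) (norm_translate_le hpos hsub hC x) hf hg]
  congr 2 with y
  have hy : (ω (x * y) : ℂ) ≠ 0 := by exact_mod_cast (hpos _).ne'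
  rw [rhoW_eq, mul_div_cancel₀ _ hy]
  simp only [mul_assoc]

theorem rhoW_deltaOne (hpos : ∀ x, 0 < ω x) (h : Γ → ℂ) : rhoW ω (deltaOne Γ) h = h := by
  ext x
  have hx : (ω x : ℂ) ≠ 0 := by exact_mod_cast (hpos _).ne'
  rw [rhoW_eq, tsum_eq_single 1 (fun y hy => by simp [deltaOne, hy])]
  simp [deltaOne, hx]

theorem isBddFun_rhoW (hpos : ∀ x, 0 < ω x) (hsub : ∀ x y, ω (x * y) ≤ ω x * ω y)
    (hf : WeightedSummable ω f) (hh : IsBddFun h) : IsBddFun (rhoW ω f h) := by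
  obtain ⟨C, hC⟩ := hh
  refine ⟨C * ∑' y, ‖f y‖ * ω y, fun x => ?_⟩
  rw [rhoW_eq, norm_div, norm_ofReal_weight hpos, one_mul, div_le_iff₀ (hpos x)]
  refine (tsum_of_norm_bounded (Summable.hasSum hf |>.mul_left (C * ω x)) fun y => ?_).trans_eq
    (by ring)
  rw [norm_mul]
  nlinarith [mul_le_mul_of_nonneg_right (norm_translate_le hpos hsub hC x y) (norm_nonneg (f y))]

end Operator

section Lp

variable {Γ : Type*} [Group Γ] {ω : Γ → ℝ} {f : Γ → ℂ}

/-- Right convolution by `f`, transported to the unweighted `ℓ¹(Γ)`. -/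
noncomputable def convRight (hpos : ∀ x, 0 < ω x) (hsub : ∀ x y, ω (x * y) ≤ ω x * ω y)
    (hf : WeightedSummable ω f) :
    lp (fun _ : Γ => ℂ) 1 →L[ℂ] lp (fun _ : Γ => ℂ) 1 :=
  LinearMap.mkContinuous
    { toFun A := (weightedSummable_conv_and_le hpos hsub
        (weightedSummable_div hpos A) hf).1.toLp hpos
      map_add' A B := by
        ext z
        simp only [WeightedSummable.toLp, lp.coeFn_add, Pi.add_apply, conv, ← add_mul]
        rw [← (summable_conv hpos hsub (weightedSummable_div hpos A) hf z).tsum_add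
          (summable_conv hpos hsub (weightedSummable_div hpos B) hf z)]
        simp only [add_div, add_mul]
      map_smul' r A := by
        ext z
        simp only [WeightedSummable.toLp, lp.coeFn_smul, Pi.smul_apply, smul_eq_mul, conv,
          RingHom.id_apply, ← mul_assoc, ← tsum_mul_left, mul_div_assoc] }
    (∑' x, ‖f x‖ * ω x) fun A => by
      have h := weightedSummable_conv_and_le hpos hsub (weightedSummable_div hpos A) hf
      refine (norm_toLp hpos h.1).trans_le (h.2.trans_eq ?_)
      rw [← norm_toLp hpos (weightedSummable_div hpos A), toLp_div, mul_comm]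

theorem convRight_apply (hpos : ∀ x, 0 < ω x) (hsub : ∀ x y, ω (x * y) ≤ ω x * ω y)
    (hf : WeightedSummable ω f) (A : lp (fun _ : Γ => ℂ) 1) (z : Γ) :
    convRight hpos hsub hf A z = conv (fun x => A x / ω x) f z * ω z := rfl

theorem norm_convRight_le (hpos : ∀ x, 0 < ω x) (hsub : ∀ x y, ω (x * y) ≤ ω x * ω y)
    (hf : WeightedSummable ω f) : ‖convRight hpos hsub hf‖ ≤ ∑' x, ‖f x‖ * ω x :=
  LinearMap.mkContinuous_norm_le _
    (tsum_nonneg fun x => mul_nonneg (norm_nonneg _) (hpos x).le) _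

/-- If `‖δ_e - f‖ < 1` then `f` has a left inverse in `ℓ¹(Γ,ω)`. -/
theorem exists_conv_eq_deltaOne (hpos : ∀ x, 0 < ω x) (hsub : ∀ x y, ω (x * y) ≤ ω x * ω y)
    (hf : WeightedSummable ω f) (hlt : ∑' x, ‖(deltaOne Γ - f) x‖ * ω x < 1) :
    ∃ b, WeightedSummable ω b ∧ conv b f = deltaOne Γ := by
  have hδ : WeightedSummable ω (deltaOne Γ) := weightedSummable_deltaOne
  let T := convRight hpos hsub (hδ.sub hf hpos)
  have hT : ‖T‖ < 1 := (norm_convRight_le hpos hsub _).trans_lt hlt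
  let u := Units.oneSub T hT
  let B := (↑u⁻¹ : lp (fun _ : Γ => ℂ) 1 →L[ℂ] lp (fun _ : Γ => ℂ) 1) (hδ.toLp hpos)
  have hB : B - T B = hδ.toLp hpos := congrArg (fun S => S (hδ.toLp hpos)) u.mul_inv
  refine ⟨_, weightedSummable_div hpos B, funext fun z => ?_⟩
  have hz : (ω z : ℂ) ≠ 0 := by exact_mod_cast (hpos _).ne'
  have h := congrArg (fun S : lp (fun _ : Γ => ℂ) 1 => S z) hB
  simp only [lp.coeFn_sub, Pi.sub_apply, T, convRight_apply,
    conv_sub_left hpos hsub (weightedSummable_div hpos B) hδ hf, conv_deltaOne, sub_mul,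
    div_mul_cancel₀ _ hz, sub_sub_cancel] at h
  exact mul_right_cancel₀ hz h

theorem convRight_single (hpos : ∀ x, 0 < ω x) (hsub : ∀ x y, ω (x * y) ≤ ω x * ω y)
    (hf : WeightedSummable ω f) [DecidableEq Γ] (x z : Γ) :
    convRight hpos hsub hf (lp.single 1 x 1) z = f (x⁻¹ * z) / ω x * ω z := by
  rw [convRight_apply, conv_eq_tsum_left, tsum_eq_single x (fun y hy => by simp [hy])]
  simp [div_eq_mul_inv]

theorem denseRange_convRight (hpos : ∀ x, 0 < ω x) (hsub : ∀ x y, ω (x * y) ≤ ω x * ω y)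
    (hf : WeightedSummable ω f)
    (hinj : ∀ g : Γ → ℂ, IsBddFun g → rhoW ω f g = 0 → g = 0) :
    DenseRange (convRight hpos hsub hf) := by
  classical
  let T := convRight hpos hsub hf
  let M := T.range.topologicalClosure
  have hM : IsClosed (M : Set (lp (fun _ : Γ => ℂ) 1)) := Submodule.isClosed_topologicalClosure _
  intro A
  change A ∈ M
  by_contra hA
  obtain ⟨ψ, hψ⟩ := SeparatingDual.exists_ne_zero (R := ℂ) (x := M.mkQ A)
    (by simpa using hA)
  let φ : lp (fun _ : Γ => ℂ) 1 →L[ℂ] ℂ := ψ.comp M.mkQL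
  have hφT : ∀ B, φ (T B) = 0 := fun B => by
    have : T B ∈ M := Submodule.le_topologicalClosure _ ⟨B, rfl⟩
    simp [φ, (Submodule.Quotient.mk_eq_zero M).2 this]
  have hφ : ∀ B : lp (fun _ : Γ => ℂ) 1, φ B = ∑' x, B x * φ (lp.single 1 x 1) := fun B => by
    rw [← ((lp.hasSum_single (by simp) B).mapL φ).tsum_eq]
    congr 1 with x
    rw [← smul_eq_mul, ← map_smul, ← lp.single_smul, smul_eq_mul, mul_one]
  have hbdd : IsBddFun fun x => φ (lp.single 1 x 1) :=
    ⟨‖φ‖, fun x => (φ.le_opNorm _).trans_eq (by simp [lp.norm_single])⟩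
  have hg := hinj _ hbdd <| funext fun x => by
    have h := hφT (lp.single 1 x 1)
    rw [hφ, ← (Equiv.mulLeft x).tsum_eq] at h
    rw [rhoW_eq, div_eq_mul_inv, ← tsum_mul_right, Pi.zero_apply, ← h]
    congr 1 with y
    simp only [T, convRight_single, Equiv.coe_mulLeft, inv_mul_cancel_left]
    ring
  apply hψ
  have h := hφ A
  simp only [fun x => congrFun hg x, Pi.zero_apply, mul_zero, tsum_zero] at h
  exact h

/-- If `ρ^ω_f` has trivial kernel then `f` has a left inverse in `ℓ¹(Γ,ω)`. -/
theorem exists_left_inverse_of_rhoW_ker (hpos : ∀ x, 0 < ω x)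
    (hsub : ∀ x y, ω (x * y) ≤ ω x * ω y) (hf : WeightedSummable ω f)
    (hinj : ∀ g : Γ → ℂ, IsBddFun g → rhoW ω f g = 0 → g = 0) :
    ∃ b, WeightedSummable ω b ∧ conv b f = deltaOne Γ := by
  have hδ : WeightedSummable ω (deltaOne Γ) := weightedSummable_deltaOne
  obtain ⟨A, hA⟩ := (denseRange_convRight hpos hsub hf hinj).exists_dist_lt
    (hδ.toLp hpos) one_pos
  have ha := weightedSummable_div hpos A
  have haf := (weightedSummable_conv_and_le hpos hsub ha hf).1
  have hlt : ∑' x, ‖(deltaOne Γ - conv (fun x => A x / ω x) f) x‖ * ω x < 1 := by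
    have h : (hδ.sub haf hpos).toLp hpos = hδ.toLp hpos - convRight hpos hsub hf A := by
      ext x
      exact sub_mul _ _ _
    rwa [← norm_toLp hpos (hδ.sub haf hpos), h, ← dist_eq_norm]
  obtain ⟨b, hb, hbf⟩ := exists_conv_eq_deltaOne hpos hsub haf hlt
  exact ⟨_, (weightedSummable_conv_and_le hpos hsub hb ha).1,
    (conv_assoc hpos hsub hb ha hf).trans hbf⟩

end Lp

/-- If `(Γ,ω)` is a directly finite weighted group and `f ∈ ℓ¹(Γ,ω)`, then the following are
equivalent: `ρ^ω_f : ℓ∞(Γ) → ℓ∞(Γ)` is injective; `ρ^ω_f` is bijective;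
`f` is invertible in `ℓ¹(Γ,ω)`. -/
theorem stmt15 {Γ : Type*} [Group Γ] (ω : Γ → ℝ)
    (hωpos : ∀ x, 0 < ω x) (hωsub : ∀ x y, ω (x * y) ≤ ω x * ω y)
    (hDF : ∀ a b : Γ → ℂ, (Summable fun x => ‖a x‖ * ω x) → (Summable fun x => ‖b x‖ * ω x) →
      conv b a = deltaOne Γ → conv a b = deltaOne Γ)
    (f : Γ → ℂ) (hf : Summable fun x => ‖f x‖ * ω x) :
    List.TFAE
      [∀ g₁ g₂ : Γ → ℂ, IsBddFun g₁ → IsBddFun g₂ → rhoW ω f g₁ = rhoW ω f g₂ → g₁ = g₂,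
       (∀ g₁ g₂ : Γ → ℂ, IsBddFun g₁ → IsBddFun g₂ → rhoW ω f g₁ = rhoW ω f g₂ → g₁ = g₂) ∧
         (∀ h : Γ → ℂ, IsBddFun h → ∃ g : Γ → ℂ, IsBddFun g ∧ rhoW ω f g = h),
       ∃ g : Γ → ℂ, (Summable fun x => ‖g x‖ * ω x) ∧
         conv f g = deltaOne Γ ∧ conv g f = deltaOne Γ] := by
  tfae_have 2 → 1 := fun h => h.1
  tfae_have 1 → 3 := fun hinj => by
    have hzero : rhoW ω f 0 = 0 := by
      ext x
      simp [rhoW]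
    obtain ⟨b, hb, hbf⟩ := exists_left_inverse_of_rhoW_ker hωpos hωsub hf fun g hg h =>
      hinj g 0 hg ⟨0, by simp⟩ (h.trans hzero.symm)
    exact ⟨b, hb, hDF f b hf hb hbf, hbf⟩
  tfae_have 3 → 2 := by
    rintro ⟨g, hg, hfg, hgf⟩
    refine ⟨fun g₁ g₂ h₁ h₂ h => ?_, fun h hh => ⟨rhoW ω g h, isBddFun_rhoW hωpos hωsub hg hh, ?_⟩⟩
    · rw [← rhoW_deltaOne hωpos g₁, ← rhoW_deltaOne hωpos g₂, ← hgf,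
        ← rhoW_rhoW hωpos hωsub hg hf h₁, ← rhoW_rhoW hωpos hωsub hg hf h₂, h]
    · rw [rhoW_rhoW hωpos hωsub hf hg hh, hfg, rhoW_deltaOne hωpos]
  tfae_finish
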